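/- Let A be a commutative unital C*-algebra and let M be a finitely generated projective A-module. If α and β are two positive definite A-hermitian inner products on M, then there exists an A-module automorphism f of M such that β(f x, f y) = α(x, y) for all x, y ∈ M; that is, the positive definite A-hermitian inner product on M is unique up to an A-module automorphism. -/

import Mathlib

/-- A positive definite `A`-hermitian inner product on an `A`-module `M`. -/
def IsHermitianInnerProduct (A : Type*) [CommRing A] [StarRing A] [PartialOrder A]
    (M : Type*) [AddCommGroup M] [Module A M] (α : M → M → A) : Prop :=
  (∀ (a : A) (x y z : M), α (a • x + y) z = a * α x z + α y z) ∧
  (∀ x y : M, α y x = star (α x y)) ∧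
  (∀ x : M, 0 ≤ α x x) ∧
  (∀ φ : M →ₗ[A] A, ∃! x : M, ∀ y : M, φ y = α y x)

theorem isUnit_add_one_sub_mul_star {B : Type*} [CStarAlgebra B] [PartialOrder B]
    [StarOrderedRing B] {N c p : B} (hN : 0 ≤ N) (hp : p = N * c) :
    IsUnit (N + (1 - p) * star (1 - p)) := by
  set n := CFC.sqrt N
  have hn : n * n = N := CFC.sqrt_mul_sqrt_self N
  have hns : star n = n := (CFC.sqrt_nonneg N).isSelfAdjoint
  have hNs : star N = N := hN.isSelfAdjoint
  set d := n * c * star (n * c) with hd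
  have hds : IsSelfAdjoint d := .mul_star_self _
  have h1 : p * star p ≤ ‖d‖ • N := by
    have := CStarAlgebra.star_right_conjugate_le_norm_smul (a := n) hds
    rw [hns, hn] at this
    convert this using 1
    rw [hp, star_mul, hNs, hd, star_mul, hns, ← hn]
    noncomm_ring
  have h2 : (1 : B) ≤ (2 : ℝ) • (p * star p + (1 - p) * star (1 - p)) := by
    rw [← sub_nonneg]
    convert mul_star_self_nonneg (p - (1 - p)) using 1
    rw [two_smul, star_sub, star_sub, star_sub, star_one]
    noncomm_ring
  have h3 : (2 : ℝ) • (p * star p + (1 - p) * star (1 - p)) ≤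
      (2 * (1 + ‖d‖)) • (N + (1 - p) * star (1 - p)) := by
    rw [mul_smul]
    gcongr
    rw [add_smul, one_smul, smul_add]
    have h4 : 0 ≤ ‖d‖ • ((1 - p) * star (1 - p)) :=
      smul_nonneg (norm_nonneg _) (mul_star_self_nonneg _)
    calc _ ≤ 0 + ‖d‖ • N + (0 + (1 - p) * star (1 - p)) := by
            rw [zero_add, zero_add]; gcongr
      _ ≤ N + ‖d‖ • N + (‖d‖ • ((1 - p) * star (1 - p)) + (1 - p) * star (1 - p)) := by gcongr
      _ = _ := by abel
  have h5 := CStarAlgebra.isUnit_of_le _ (h2.trans h3)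
  have h6 : (2 * (1 + ‖d‖)) ≠ 0 := by positivity
  exact (isUnit_smul_iff (Units.mk0 _ h6) _).1 h5

/-- Two positive invertible elements `H`, `K` are congruent, through a unit commuting with any `P`
that is self-adjoint for both of the forms `H` and `K`. -/
theorem exists_unit_star_mul_mul_eq {B : Type*} [CStarAlgebra B] [PartialOrder B]
    [StarOrderedRing B] {H K P : B} (hH : 0 ≤ H) (hHu : IsUnit H) (hK : 0 ≤ K) (hKu : IsUnit K)
    (hHP : H * P = star P * H) (hKP : K * P = star P * K) :
    ∃ U : Bˣ, star (U : B) * H * U = K ∧ Commute (U : B) P := by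
  obtain ⟨r, hr⟩ := (CFC.isUnit_sqrt_iff H).2 hHu
  have hrr : (r : B) * r = H := by rw [hr]; exact CFC.sqrt_mul_sqrt_self H
  have hrs : star r = r := Units.ext (by
    rw [Units.coe_star, hr]; exact (CFC.sqrt_nonneg H).isSelfAdjoint)
  have hris : star (r⁻¹ : Bˣ) = r⁻¹ := by rw [star_inv, hrs]
  have hris' : star ((r⁻¹ : Bˣ) : B) = (r⁻¹ : Bˣ) := by rw [← Units.coe_star, hris]
  have hrs' : star (r : B) = r := by rw [← Units.coe_star, hrs]
  set L : B := (r⁻¹ : Bˣ) * K * (r⁻¹ : Bˣ) with hL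
  have hL0 : 0 ≤ L := by
    have := star_left_conjugate_nonneg hK ((r⁻¹ : Bˣ) : B)
    rwa [hris'] at this
  have hLu : IsUnit L := ((r⁻¹).isUnit.mul hKu).mul (r⁻¹).isUnit
  obtain ⟨w, hw⟩ := (CFC.isUnit_sqrt_iff L).2 hLu
  have hww : (w : B) * w = L := by rw [hw]; exact CFC.sqrt_mul_sqrt_self L
  have hws : star (w : B) = w := by rw [hw]; exact (CFC.sqrt_nonneg L).isSelfAdjoint
  have hPr : P * (r⁻¹ : Bˣ) * (r⁻¹ : Bˣ) = (r⁻¹ : Bˣ) * (r⁻¹ : Bˣ) * star P := by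
    rw [← hrr] at hHP
    calc P * (r⁻¹ : Bˣ) * (r⁻¹ : Bˣ)
        = (r⁻¹ : Bˣ) * (r⁻¹ : Bˣ) * (r * r * P) * (r⁻¹ : Bˣ) * (r⁻¹ : Bˣ) := by
          simp [mul_assoc]
      _ = _ := by rw [hHP]; simp [mul_assoc]
  have hLP : Commute L (r * P * (r⁻¹ : Bˣ)) := by
    change (r⁻¹ : Bˣ) * K * (r⁻¹ : Bˣ) * (r * P * (r⁻¹ : Bˣ)) =
      r * P * (r⁻¹ : Bˣ) * ((r⁻¹ : Bˣ) * K * (r⁻¹ : Bˣ))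
    calc _ = (r⁻¹ : Bˣ) * (K * P) * (r⁻¹ : Bˣ) := by simp [mul_assoc]
      _ = r * (((r⁻¹ : Bˣ) * (r⁻¹ : Bˣ) * star P) * K) * (r⁻¹ : Bˣ) := by
          rw [hKP]; simp [mul_assoc]
      _ = _ := by rw [← hPr]; simp only [mul_assoc]
  have hwP : Commute (w : B) (r * P * (r⁻¹ : Bˣ)) := by
    rw [hw]; exact hLP.cfcₙ_nnreal NNReal.sqrt
  refine ⟨r⁻¹ * w * r, ?_, ?_⟩
  · calc star ((r⁻¹ * w * r : Bˣ) : B) * H * (r⁻¹ * w * r : Bˣ)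
        = r * (w * w) * r := by
          rw [← hrr]; simp [mul_assoc, hws, hrs', hris']
      _ = K := by rw [hww, hL]; simp [mul_assoc]
  · calc ((r⁻¹ * w * r : Bˣ) : B) * P
        = (r⁻¹ : Bˣ) * (w * (r * P * (r⁻¹ : Bˣ))) * r := by simp [mul_assoc]
      _ = _ := by rw [hwP.eq]; simp [mul_assoc]

/-- Two positive elements supported on the same idempotent `p`, and invertible there, are congruent
through a unit commuting with `p`. -/
theorem exists_unit_mul_mul_star_eq_of_idempotent {B : Type*} [CStarAlgebra B] [PartialOrder B]
    [StarOrderedRing B] {N₁ N₂ c₁ c₂ p : B} (h₁ : 0 ≤ N₁) (h₂ : 0 ≤ N₂) (hp : p * p = p)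
    (hp₁ : p = N₁ * c₁) (hp₂ : p = N₂ * c₂) (hN₁ : p * N₁ = N₁) (hN₂ : p * N₂ = N₂) :
    ∃ V : Bˣ, (V : B) * N₂ * star (V : B) = N₁ ∧ Commute (V : B) p := by
  have key : ∀ N : B, 0 ≤ N → p * N = N →
      (N + (1 - p) * star (1 - p)) * star p = N ∧ p * (N + (1 - p) * star (1 - p)) = N := by
    intro N h hN
    have hpq : p * (1 - p) = 0 := by rw [mul_sub, hp, mul_one, sub_self]
    have hqp : star (1 - p) * star p = 0 := by rw [← star_mul, hpq, star_zero]
    have hNp : N * star p = N := by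
      simpa [h.isSelfAdjoint.star_eq] using congrArg star hN
    exact ⟨by rw [add_mul, mul_assoc, hqp, mul_zero, add_zero, hNp],
      by rw [mul_add, ← mul_assoc, hpq, zero_mul, add_zero, hN]⟩
  have hpos : ∀ N : B, 0 ≤ N → 0 ≤ N + (1 - p) * star (1 - p) := fun N h ↦
    add_nonneg h (mul_star_self_nonneg _)
  obtain ⟨k₁, k₁'⟩ := key N₁ h₁ hN₁
  obtain ⟨k₂, k₂'⟩ := key N₂ h₂ hN₂
  obtain ⟨U, hU, hUp⟩ := exists_unit_star_mul_mul_eq (P := star p) (hpos N₂ h₂)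
    (isUnit_add_one_sub_mul_star h₂ hp₂) (hpos N₁ h₁)
    (isUnit_add_one_sub_mul_star h₁ hp₁)
    (by rw [star_star, k₂, k₂']) (by rw [star_star, k₁, k₁'])
  refine ⟨star U, ?_, by simpa using hUp.star_star⟩
  rw [Units.coe_star, star_star]
  calc star (U : B) * N₂ * U
      = star (U : B) * (N₂ + (1 - p) * star (1 - p)) * (star p * U) := by
        rw [← mul_assoc, mul_assoc _ _ (star p), k₂]
    _ = N₁ := by rw [← hUp.eq, ← mul_assoc, hU, k₁]

theorem IsSelfAdjoint.exists_mul_star_eq_neg_conjugate {B : Type*} [CStarAlgebra B] [PartialOrder B]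
    [StarOrderedRing B] {H : B} (hs : IsSelfAdjoint H) :
    ∃ h t : B, IsSelfAdjoint h ∧ t * star t = -(h * H * h) ∧ (t = 0 → 0 ≤ H) := by
  set h := H⁻
  have hh : star h = h := (CFC.negPart_nonneg H).isSelfAdjoint
  set s := CFC.sqrt h
  have hss : s * s = h := CFC.sqrt_mul_sqrt_self h (CFC.negPart_nonneg H)
  have hst : star s = s := (CFC.sqrt_nonneg h).isSelfAdjoint
  refine ⟨h, h * s, hh, ?_, fun h0 ↦ ?_⟩
  · have e : H = H⁺ - h := (CFC.posPart_sub_negPart H hs).symm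
    have e' : h * H⁺ = 0 := CFC.negPart_mul_posPart H
    rw [e, mul_sub, e', star_mul, hh, hst, ← mul_assoc, mul_assoc h s s, hss]
    noncomm_ring
  · rw [← CFC.negPart_eq_zero_iff H hs]
    have : star h * h = 0 := by rw [hh, ← hss, ← mul_assoc, hss, h0, zero_mul]
    exact CStarRing.star_mul_self_eq_zero_iff _ |>.1 this

theorem CStarMatrix.nonneg_of_forall_sum_nonneg {A n : Type*} [CStarAlgebra A] [PartialOrder A]
    [StarOrderedRing A] [Fintype n] [DecidableEq n] {H : CStarMatrix n n A} (hs : IsSelfAdjoint H)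
    (hH : ∀ a : n → A, 0 ≤ ∑ i, ∑ j, a i * H i j * star (a j)) : 0 ≤ H := by
  obtain ⟨h, t, hh, hsand, himp⟩ := hs.exists_mul_star_eq_neg_conjugate
  refine himp (CStarMatrix.ext fun i j ↦ ?_)
  have h1 : (t * star t) i i = ∑ j, t i j * star (t i j) := by
    rw [CStarMatrix.mul_apply]; rfl
  have h2 : 0 ≤ (h * H * h) i i := by
    convert hH (h i) using 1
    rw [CStarMatrix.mul_apply, Finset.sum_comm]
    refine Finset.sum_congr rfl fun k _ ↦ ?_
    rw [CStarMatrix.mul_apply, Finset.sum_mul]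
    refine Finset.sum_congr rfl fun l _ ↦ ?_
    rw [CStarMatrix.star_apply_of_isSelfAdjoint hh]
  have h3 : ∑ j, t i j * star (t i j) = 0 :=
    le_antisymm (by rw [← h1, hsand]; simpa using h2)
      (Finset.sum_nonneg fun _ _ ↦ mul_star_self_nonneg _)
  rw [Finset.sum_eq_zero_iff_of_nonneg fun _ _ ↦ mul_star_self_nonneg _] at h3
  simpa using h3 j (Finset.mem_univ j)

namespace IsHermitianInnerProduct

variable {A M : Type*} [CommRing A] [StarRing A] [PartialOrder A] [AddCommGroup M] [Module A M]
  {α : M → M → A}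

theorem map_zero_left (h : IsHermitianInnerProduct A M α) (z : M) : α 0 z = 0 := by
  have := h.1 1 0 0 z
  simpa using this

theorem map_sum_smul_left (h : IsHermitianInnerProduct A M α) {ι : Type*} (s : Finset ι)
    (a : ι → A) (g : ι → M) (z : M) : α (∑ i ∈ s, a i • g i) z = ∑ i ∈ s, a i * α (g i) z := by
  classical
  induction s using Finset.induction_on with
  | empty => simpa using h.map_zero_left z
  | insert i s hi ih => rw [Finset.sum_insert hi, Finset.sum_insert hi, h.1, ih]

theorem map_sum_smul_right (h : IsHermitianInnerProduct A M α) {ι : Type*} (s : Finset ι)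
    (a : ι → A) (g : ι → M) (z : M) :
    α z (∑ i ∈ s, a i • g i) = ∑ i ∈ s, α z (g i) * star (a i) := by
  rw [h.2.1, h.map_sum_smul_left, star_sum]
  refine Finset.sum_congr rfl fun i _ ↦ ?_
  rw [star_mul, ← h.2.1]

theorem map_sum_smul_sum_smul (h : IsHermitianInnerProduct A M α) {ι : Type*} (s : Finset ι)
    (a b : ι → A) (g : ι → M) :
    α (∑ i ∈ s, a i • g i) (∑ i ∈ s, b i • g i) =
      ∑ i ∈ s, ∑ j ∈ s, a i * α (g i) (g j) * star (b j) := by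
  rw [h.map_sum_smul_left]
  refine Finset.sum_congr rfl fun i _ ↦ ?_
  rw [h.map_sum_smul_right, Finset.mul_sum]
  simp only [mul_assoc]

theorem exists_matrix_mul_eq (h : IsHermitianInnerProduct A M α) {n : Type*} [Fintype n]
    {g : n → M} {φ : n → M →ₗ[A] A} (hg : ∀ x, ∑ i, φ i x • g i = x) :
    ∃ c : Matrix n n A, Matrix.of (fun i j ↦ φ j (g i)) =
      Matrix.of (fun i j ↦ α (g i) (g j)) * c := by
  choose u hu using fun j ↦ (h.2.2.2 (φ j)).exists
  refine ⟨Matrix.of fun k j ↦ star (φ k (u j)), ?_⟩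
  ext i j
  rw [Matrix.mul_apply]
  simp only [Matrix.of_apply]
  rw [hu, ← h.map_sum_smul_right, hg]

theorem matrix_mul_gram (h : IsHermitianInnerProduct A M α) {n : Type*} [Fintype n]
    {g : n → M} {φ : n → M →ₗ[A] A} (hg : ∀ x, ∑ i, φ i x • g i = x) :
    Matrix.of (fun i j ↦ φ j (g i)) * Matrix.of (fun i j ↦ α (g i) (g j)) =
      Matrix.of (fun i j ↦ α (g i) (g j)) := by
  ext i j
  rw [Matrix.mul_apply]
  simp only [Matrix.of_apply]
  rw [← h.map_sum_smul_left, hg]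

end IsHermitianInnerProduct

/-- The endomorphism of `M` with matrix `V` in the generators `g`, where `φ` is dual to `g`. -/
def endOfMatrix {A M n : Type*} [CommRing A] [AddCommGroup M] [Module A M] [Fintype n]
    (g : n → M) (φ : n → M →ₗ[A] A) (V : Matrix n n A) : M →ₗ[A] M :=
  ∑ i, (φ i).smulRight (∑ j, V i j • g j)

section

variable {A M n : Type*} [CommRing A] [AddCommGroup M] [Module A M] [Fintype n]
  {g : n → M} {φ : n → M →ₗ[A] A}

theorem endOfMatrix_apply (V : Matrix n n A) (x : M) :
    endOfMatrix g φ V x = ∑ i, φ i x • ∑ j, V i j • g j := by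
  simp [endOfMatrix]

theorem Matrix.sum_mul_apply_smul (V W : Matrix n n A) (i : n) :
    ∑ k, (V * W) i k • g k = ∑ j, V i j • ∑ k, W j k • g k := by
  simp only [Matrix.mul_apply, Finset.sum_smul, Finset.smul_sum, smul_smul]
  exact Finset.sum_comm

theorem endOfMatrix_apply_generator (hg : ∀ x, ∑ i, φ i x • g i = x) {V : Matrix n n A}
    (hV : Commute V (Matrix.of fun i j ↦ φ j (g i))) (i : n) :
    endOfMatrix g φ V (g i) = ∑ j, V i j • g j := by
  rw [endOfMatrix_apply]
  have h := Matrix.sum_mul_apply_smul (g := g) (Matrix.of fun i j ↦ φ j (g i)) V i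
  rw [← hV.eq, Matrix.sum_mul_apply_smul] at h
  simpa only [Matrix.of_apply, hg] using h.symm

theorem endOfMatrix_endOfMatrix [DecidableEq n] (hg : ∀ x, ∑ i, φ i x • g i = x)
    {V W : Matrix n n A} (hV : Commute V (Matrix.of fun i j ↦ φ j (g i)))
    (hW : Commute W (Matrix.of fun i j ↦ φ j (g i))) (hWV : W * V = 1) (x : M) :
    endOfMatrix g φ V (endOfMatrix g φ W x) = x := by
  conv_rhs => rw [← hg x]
  conv_lhs => rw [← hg x]
  simp only [map_sum, map_smul, endOfMatrix_apply_generator hg hV,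
    endOfMatrix_apply_generator hg hW, ← Matrix.sum_mul_apply_smul, hWV,
    Matrix.one_apply, ite_smul, zero_smul, one_smul, Finset.sum_ite_eq, Finset.mem_univ, if_true]

end

/-- On a finitely generated projective module over a commutative unital C*-algebra,
the positive definite `A`-hermitian inner product is unique up to an `A`-module
automorphism: if `α` and `β` are two such products, there is an automorphism `f`
of `M` with `β (f x) (f y) = α x y` for all `x y`. -/
theorem hermitian_inner_product_unique_up_to_automorphism
    (A : Type*) [NormedCommRing A] [StarRing A] [CStarRing A] [NormedAlgebra ℂ A]
    [StarModule ℂ A] [CompleteSpace A] [PartialOrder A] [StarOrderedRing A]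
    (M : Type*) [AddCommGroup M] [Module A M]
    [Module.Finite A M] [Module.Projective A M]
    (α β : M → M → A)
    (hα : IsHermitianInnerProduct A M α) (hβ : IsHermitianInnerProduct A M β) :
    ∃ f : M ≃ₗ[A] M, ∀ x y : M, β (f x) (f y) = α x y := by
  obtain ⟨n, F, G, -, -, hFG⟩ := Module.Finite.exists_comp_eq_id_of_projective A M
  let g : Fin n → M := fun i ↦ F (Pi.single i 1)
  let φ : Fin n → M →ₗ[A] A := fun i ↦ LinearMap.proj i ∘ₗ G
  have hg : ∀ x, ∑ i, φ i x • g i = x := fun x ↦ by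
    have hx := LinearMap.congr_fun hFG x
    rw [LinearMap.comp_apply, pi_eq_sum_univ' (G x)] at hx
    simpa [g, φ, Pi.single_apply] using hx
  let _ : CStarAlgebra A := { }
  have gram_nonneg : ∀ γ : M → M → A, IsHermitianInnerProduct A M γ →
      0 ≤ CStarMatrix.ofMatrix (Matrix.of fun i j ↦ γ (g i) (g j)) := fun γ hγ ↦
    CStarMatrix.nonneg_of_forall_sum_nonneg
      (CStarMatrix.ext fun i j ↦ (hγ.2.1 (g j) (g i)).symm)
      (fun a ↦ (hγ.map_sum_smul_sum_smul Finset.univ a a g).symm ▸ hγ.2.2.1 _)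
  obtain ⟨c₁, hc₁⟩ := hα.exists_matrix_mul_eq hg
  obtain ⟨c₂, hc₂⟩ := hβ.exists_matrix_mul_eq hg
  have hp : Matrix.of (fun i j ↦ φ j (g i)) * Matrix.of (fun i j ↦ φ j (g i)) =
      Matrix.of (fun i j ↦ φ j (g i)) := by
    nth_rw 2 [hc₁]
    rw [← mul_assoc, hα.matrix_mul_gram hg, ← hc₁]
  obtain ⟨V, hV, hVp⟩ := exists_unit_mul_mul_star_eq_of_idempotent (gram_nonneg α hα)
    (gram_nonneg β hβ) hp hc₁ hc₂ (hα.matrix_mul_gram hg) (hβ.matrix_mul_gram hg)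
  have hV1 := V.mul_inv
  have hV2 := V.inv_mul
  have hWp := hVp.units_inv_left
  refine ⟨LinearEquiv.ofLinearMap (endOfMatrix g φ (V : CStarMatrix _ _ A))
    (endOfMatrix g φ (V⁻¹ : (CStarMatrix _ _ A)ˣ).val)
    (LinearMap.ext (endOfMatrix_endOfMatrix hg hVp hWp hV2))
    (LinearMap.ext (endOfMatrix_endOfMatrix hg hWp hVp hV1)), fun x y ↦ ?_⟩
  have hgen : ∀ i k, β (endOfMatrix g φ (V : CStarMatrix _ _ A) (g i))
      (endOfMatrix g φ (V : CStarMatrix _ _ A) (g k)) = α (g i) (g k) := fun i k ↦ by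
    rw [endOfMatrix_apply_generator hg hVp, endOfMatrix_apply_generator hg hVp,
      hβ.map_sum_smul_sum_smul, Finset.sum_comm]
    have h := CStarMatrix.ext_iff.2 hV i k
    rw [CStarMatrix.mul_apply] at h
    simp only [CStarMatrix.mul_apply, Finset.sum_mul] at h
    exact h
  rw [LinearEquiv.coe_ofLinearMap, ← hg x, ← hg y]
  simp only [map_sum, map_smul]
  rw [hβ.map_sum_smul_sum_smul, hα.map_sum_smul_sum_smul]
  simp only [hgen]
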